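/- Let k > 0, let f : (0,∞) → ℝ be k-convex on (0,∞) with f(1) = 0, let 0 ≤ ε ≤ 1, and let P and Q be probability distributions on Fin n → Bool with P(x) > 0 and Q(x) > 0 for all x. If D_f(P‖Q) < k·ε², then for every subset S ⊆ Fin n and every assignment y : Fin n → Bool, |P(E) − Q(E)| < ε, where E = {x : x(i) = y(i) for all i ∈ S}. (Theorem B.1: bounded k-convex f-divergence implies absolute approximation of all marginals.) -/

import Mathlib

/-- A `k`-convex function on `(0, ∞)` becomes convex after subtracting `k x² / 2`. -/
theorem convexOn_sub_sq_of_kconvex (k : ℝ) (f : ℝ → ℝ)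
    (hkconv : ∀ x ∈ Set.Ioi (0 : ℝ), ∀ y ∈ Set.Ioi (0 : ℝ),
      ∀ t ∈ Set.Icc (0 : ℝ) 1,
        f ((1 - t) * x + t * y) ≤
          (1 - t) * f x + t * f y - k * t * (1 - t) * (x - y) ^ 2 / 2) :
    ConvexOn ℝ (Set.Ioi 0) (fun x => f x - k / 2 * x ^ 2) := by
  refine ⟨convex_Ioi 0, fun x hx y hy a b _ hb hab => ?_⟩
  obtain rfl : a = 1 - b := by linarith
  have h := hkconv x hx y hy b ⟨hb, by linarith⟩
  simp only [smul_eq_mul]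
  linear_combination h

/-- The `χ²`-divergence, scaled by `k / 2`, is a lower bound for a `k`-convex `f`-divergence. -/
theorem half_mul_chiSq_le_fdiv {Ω : Type*} [Fintype Ω] (k : ℝ) (f : ℝ → ℝ)
    (hconv : ConvexOn ℝ (Set.Ioi 0) (fun x => f x - k / 2 * x ^ 2))
    (hf1 : f 1 = 0) (P Q : Ω → ℝ)
    (hP0 : ∀ x, 0 < P x) (hP1 : ∑ x, P x = 1)
    (hQ0 : ∀ x, 0 < Q x) (hQ1 : ∑ x, Q x = 1) :
    k / 2 * (∑ x, P x ^ 2 / Q x - 1) ≤ ∑ x, Q x * f (P x / Q x) := by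
  have h := hconv.map_sum_le (t := Finset.univ) (w := Q) (p := fun x => P x / Q x)
    (fun x _ => (hQ0 x).le) hQ1 (fun x _ => div_pos (hP0 x) (hQ0 x))
  have hmean : ∑ x, Q x * (P x / Q x) = 1 := by
    rw [← hP1]
    exact Finset.sum_congr rfl fun x _ => mul_div_cancel₀ _ (hQ0 x).ne'
  have hsq : ∑ x, Q x * (f (P x / Q x) - k / 2 * (P x / Q x) ^ 2)
      = ∑ x, Q x * f (P x / Q x) - k / 2 * ∑ x, P x ^ 2 / Q x := by
    rw [Finset.mul_sum, ← Finset.sum_sub_distrib]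
    refine Finset.sum_congr rfl fun x _ => ?_
    have := (hQ0 x).ne'
    field_simp
  simp only [smul_eq_mul, hmean, hsq, hf1] at h
  linarith

/-- The squared discrepancy of two distributions on an event is at most a quarter of their
`χ²`-divergence. -/
theorem four_mul_sq_event_sub_le_chiSq {Ω : Type*} [Fintype Ω] (P Q : Ω → ℝ)
    (hP1 : ∑ x, P x = 1) (hQ0 : ∀ x, 0 < Q x) (hQ1 : ∑ x, Q x = 1)
    (p : Ω → Prop) [DecidablePred p] :
    4 * (∑ x with p x, P x - ∑ x with p x, Q x) ^ 2 ≤ ∑ x, P x ^ 2 / Q x - 1 := by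
  set δ := ∑ x with p x, P x - ∑ x with p x, Q x with hδ
  have hδ' : ∑ x, (if p x then P x - Q x else 0) = δ := by
    rw [← Finset.sum_filter, Finset.sum_sub_distrib]
  have hterm : ∀ x, 8 * δ * (if p x then P x - Q x else 0) - 4 * δ * (P x - Q x)
      - 4 * δ ^ 2 * Q x + 2 * P x - Q x ≤ P x ^ 2 / Q x := by
    intro x
    rw [le_div_iff₀ (hQ0 x)]
    split_ifs
    · linear_combination sq_nonneg (P x - Q x - 2 * δ * Q x)
    · linear_combination sq_nonneg (P x - Q x + 2 * δ * Q x)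
  have h := Finset.sum_le_sum fun x (_ : x ∈ Finset.univ) => hterm x
  simp only [Finset.sum_sub_distrib, Finset.sum_add_distrib, ← Finset.mul_sum, hδ', hP1, hQ1] at h
  linear_combination h


/-- Theorem B.1: bounded `k`-convex `f`-divergence implies absolute
approximation of all marginal probabilities. -/
theorem bounded_fdiv_implies_absolute_marginals {n : ℕ}
    (k : ℝ) (hk : 0 < k) (f : ℝ → ℝ)
    (hkconv : ∀ x ∈ Set.Ioi (0 : ℝ), ∀ y ∈ Set.Ioi (0 : ℝ),
      ∀ t ∈ Set.Icc (0 : ℝ) 1,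
        f ((1 - t) * x + t * y) ≤
          (1 - t) * f x + t * f y - k * t * (1 - t) * (x - y) ^ 2 / 2)
    (hf1 : f 1 = 0)
    (ε : ℝ) (hε0 : 0 ≤ ε) (hε1 : ε ≤ 1)
    (P Q : (Fin n → Bool) → ℝ)
    (hP0 : ∀ x, 0 < P x) (hP1 : ∑ x, P x = 1)
    (hQ0 : ∀ x, 0 < Q x) (hQ1 : ∑ x, Q x = 1)
    (hdiv : ∑ x, Q x * f (P x / Q x) < k * ε ^ 2) :
    ∀ (S : Finset (Fin n)) (y : Fin n → Bool),
      |(∑ x ∈ Finset.univ.filter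
          (fun x : Fin n → Bool => ∀ i ∈ S, x i = y i), P x)
        - (∑ x ∈ Finset.univ.filter
          (fun x : Fin n → Bool => ∀ i ∈ S, x i = y i), Q x)| < ε := by
  intro S y
  have hlower := half_mul_chiSq_le_fdiv k f (convexOn_sub_sq_of_kconvex k f hkconv) hf1
    P Q hP0 hP1 hQ0 hQ1
  have hevent := four_mul_sq_event_sub_le_chiSq P Q hP1 hQ0 hQ1 (fun x => ∀ i ∈ S, x i = y i)
  refine abs_lt_of_sq_lt_sq (lt_of_mul_lt_mul_left ?_ hk.le) hε0
  have hscaled := mul_le_mul_of_nonneg_left hevent (half_pos hk).le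
  have hnonneg := mul_nonneg hk.le (sq_nonneg
    (∑ x with ∀ i ∈ S, x i = y i, P x - ∑ x with ∀ i ∈ S, x i = y i, Q x))
  linarith
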